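/- Let u_1, …, u_r ∈ M_3 be hermitian and let F be a facet of L(u) = 𝔼(𝓜_3) (a face of dimension dim(L(u)) − 1). Then 𝔼|_{𝓜_3} is open at every state in 𝔼|_{𝓜_3}^{-1}(F). -/

import Mathlib

open Set Filter Topology Matrix
open scoped ComplexOrder

/-- The joint numerical range `W(u₁,u₂) ⊆ ℝ²` of two (hermitian) matrices. -/
def jointNR {d : ℕ} (u₁ u₂ : Matrix (Fin d) (Fin d) ℂ) : Set (ℝ × ℝ) :=
  {p | ∃ x : Fin d → ℂ, star x ⬝ᵥ x = 1 ∧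
    p = ((star x ⬝ᵥ u₁.mulVec x).re, (star x ⬝ᵥ u₂.mulVec x).re)}

/-- The state space `𝓜_d`: positive semidefinite matrices of trace one. -/
def stateSpace (d : ℕ) : Set (Matrix (Fin d) (Fin d) ℂ) :=
  {ρ | ρ.PosSemidef ∧ ρ.trace = 1}

/-- The expected value map `ρ ↦ (tr(u₁ρ), tr(u₂ρ))` (real for hermitian arguments). -/
noncomputable def expVal2 {d : ℕ} (u₁ u₂ : Matrix (Fin d) (Fin d) ℂ)
    (ρ : Matrix (Fin d) (Fin d) ℂ) : ℝ × ℝ :=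
  ((u₁ * ρ).trace.re, (u₂ * ρ).trace.re)

/-- `f` restricted to `K` (viewed as a map onto `L`, both with subspace topologies) is open at
`v ∈ K` if the image of every neighborhood of `v` in `K` is a neighborhood of `f v` in `L`. -/
def MapsOpenAt {X Y : Type*} [TopologicalSpace X] [TopologicalSpace Y]
    (f : X → Y) (K : Set X) (L : Set Y) (v : X) : Prop :=
  ∀ N : Set X, N ⊆ K → N ∈ nhdsWithin v K → f '' N ∈ nhdsWithin (f v) L

/-- A supporting line of `C` at `p`: the level set of a nonzero linear functional attaining
its maximum over `C` at `p`. -/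
def IsSupportingLineAt (C : Set (ℝ × ℝ)) (p : ℝ × ℝ) (l : Set (ℝ × ℝ)) : Prop :=
  ∃ (φ : (ℝ × ℝ) →ₗ[ℝ] ℝ) (c : ℝ), φ ≠ 0 ∧ l = {q | φ q = c} ∧ φ p = c ∧ ∀ q ∈ C, φ q ≤ c

/-- A corner point of `C`: a point of `C` lying on more than one supporting line. -/
def IsCornerPoint (C : Set (ℝ × ℝ)) (p : ℝ × ℝ) : Prop :=
  p ∈ C ∧ ∃ l₁ l₂ : Set (ℝ × ℝ), l₁ ≠ l₂ ∧ IsSupportingLineAt C p l₁ ∧ IsSupportingLineAt C p l₂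

/-- A round boundary point of `C`: a boundary point which is neither a corner point nor lies
in the relative interior of a flat boundary portion (a nondegenerate segment in the boundary). -/
def IsRoundBoundaryPoint (C : Set (ℝ × ℝ)) (p : ℝ × ℝ) : Prop :=
  p ∈ frontier C ∧ ¬ IsCornerPoint C p ∧
    ¬ ∃ a b : ℝ × ℝ, a ≠ b ∧ segment ℝ a b ⊆ frontier C ∧ p ∈ openSegment ℝ a b

/-- `z` is singularly generated if all unit vectors generating it are proportional. -/
def SinglyGenerated {d : ℕ} (u₁ u₂ : Matrix (Fin d) (Fin d) ℂ) (z : ℝ × ℝ) : Prop :=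
  ∀ x y : Fin d → ℂ, star x ⬝ᵥ x = 1 → star y ⬝ᵥ y = 1 →
    ((star x ⬝ᵥ u₁.mulVec x).re, (star x ⬝ᵥ u₂.mulVec x).re) = z →
    ((star y ⬝ᵥ u₁.mulVec y).re, (star y ⬝ᵥ u₂.mulVec y).re) = z →
    ∃ c : ℂ, y = c • x

/-- `z` is multiply generated if it lies in the joint numerical range but is not
singularly generated. -/
def MultiplyGenerated {d : ℕ} (u₁ u₂ : Matrix (Fin d) (Fin d) ℂ) (z : ℝ × ℝ) : Prop :=
  z ∈ jointNR u₁ u₂ ∧ ¬ SinglyGenerated u₁ u₂ z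

/-- A matrix is unitarily reducible if it is unitarily equivalent to a block diagonal matrix
with (at least) two proper diagonal blocks. -/
def UnitarilyReducible {d : ℕ} (A : Matrix (Fin d) (Fin d) ℂ) : Prop :=
  ∃ (a b : ℕ) (hab : a + b = d), 0 < a ∧ 0 < b ∧
    ∃ U ∈ Matrix.unitaryGroup (Fin d) ℂ,
      ∃ (B : Matrix (Fin a) (Fin a) ℂ) (C : Matrix (Fin b) (Fin b) ℂ),
        star U * A * U =
          Matrix.reindex (finSumFinEquiv.trans (finCongr hab))
            (finSumFinEquiv.trans (finCongr hab)) (Matrix.fromBlocks B 0 0 C)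

/-- A simplex is the convex hull of finitely many affinely independent points. -/
def IsSimplex {Y : Type*} [AddCommGroup Y] [Module ℝ Y] (S : Set Y) : Prop :=
  ∃ s : Finset Y, AffineIndependent ℝ (fun p : (s : Set Y) => (p : Y)) ∧
    S = convexHull ℝ (s : Set Y)

/-- `w` is a simplicial point of `C` if finitely many simplices contained in `C`
cover a neighborhood of `w` in `C`. -/
def IsSimplicialPoint {Y : Type*} [AddCommGroup Y] [Module ℝ Y] [TopologicalSpace Y]
    (C : Set Y) (w : Y) : Prop :=
  ∃ (m : ℕ) (S : Fin m → Set Y),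
    (∀ i, IsSimplex (S i) ∧ S i ⊆ C) ∧ (⋃ i, S i) ∈ nhdsWithin w C

/-- A face of a convex set `C`: a convex subset `F ⊆ C` such that any segment of `C` whose
relative interior meets `F` lies in `F` (i.e. `F` is convex and extreme in `C`). -/
def IsFaceOf {Y : Type*} [AddCommGroup Y] [Module ℝ Y] (C F : Set Y) : Prop :=
  Convex ℝ F ∧ IsExtreme ℝ C F

/-- The dimension of a convex set: the dimension of its affine hull. -/
noncomputable def convDim {Y : Type*} [NormedAddCommGroup Y] [NormedSpace ℝ Y]
    (C : Set Y) : ℕ :=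
  Module.finrank ℝ (affineSpan ℝ C).direction

/-- The expected value map for `r` observables. -/
noncomputable def expVal {d r : ℕ} (u : Fin r → Matrix (Fin d) (Fin d) ℂ)
    (ρ : Matrix (Fin d) (Fin d) ℂ) : Fin r → ℝ :=
  fun i => ((u i) * ρ).trace.re


section PosSemidef

variable {n : Type*} [Fintype n] [DecidableEq n]

open scoped MatrixOrder Matrix.Norms.L2Operator in
theorem Matrix.IsHermitian.exists_posSemidef_smul_one_sub {M : Matrix n n ℂ}
    (hM : M.IsHermitian) : ∃ c : ℝ, 0 ≤ c ∧ (c • (1 : Matrix n n ℂ) - M).PosSemidef := by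
  refine ⟨‖M‖, norm_nonneg _, ?_⟩
  have h := IsSelfAdjoint.le_algebraMap_norm_self (a := M) hM
  rw [Matrix.le_iff] at h
  simpa [Algebra.algebraMap_eq_smul_one] using h

open scoped MatrixOrder in
theorem Matrix.PosSemidef.exists_eq_conjTranspose_mul_self {M : Matrix n n ℂ}
    (hM : M.PosSemidef) : ∃ B : Matrix n n ℂ, M = Bᴴ * B :=
  CStarAlgebra.nonneg_iff_eq_star_mul_self.1 hM.nonneg

theorem LinearMap.exists_comp_eq_of_ker_le {k V W X : Type*} [Field k] [AddCommGroup V]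
    [Module k V] [AddCommGroup W] [Module k W] [AddCommGroup X] [Module k X]
    {f : V →ₗ[k] W} {g : V →ₗ[k] X} (h : LinearMap.ker f ≤ LinearMap.ker g) :
    ∃ l : W →ₗ[k] X, l ∘ₗ f = g := by
  obtain ⟨l, hl⟩ := LinearMap.exists_extend
    ((LinearMap.ker f).liftQ g h ∘ₗ f.quotKerEquivRange.symm.toLinearMap)
  refine ⟨l, LinearMap.ext fun x => ?_⟩
  have := LinearMap.congr_fun hl (f.quotKerEquivRange (Submodule.Quotient.mk x))
  simpa using this

theorem Matrix.PosSemidef.exists_posSemidef_sub_smul {A B : Matrix n n ℂ} (hA : A.PosSemidef)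
    (hB : B.PosSemidef) (h : LinearMap.ker A.mulVecLin ≤ LinearMap.ker B.mulVecLin) :
    ∃ ε : ℝ, 0 < ε ∧ (A - ε • B).PosSemidef := by
  obtain ⟨P, rfl⟩ := hA.exists_eq_conjTranspose_mul_self
  obtain ⟨Q, rfl⟩ := hB.exists_eq_conjTranspose_mul_self
  rw [ker_mulVecLin_conjTranspose_mul_self, ker_mulVecLin_conjTranspose_mul_self] at h
  obtain ⟨l, hl⟩ := LinearMap.exists_comp_eq_of_ker_le h
  obtain ⟨D, rfl⟩ : ∃ D : Matrix n n ℂ, D * P = Q := by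
    refine ⟨LinearMap.toMatrix' l, Matrix.ext_of_mulVec_single fun i => ?_⟩
    have := LinearMap.congr_fun hl (Pi.single i 1)
    rw [← Matrix.mulVec_mulVec, LinearMap.toMatrix'_mulVec]
    simpa using this
  obtain ⟨c, hc, hD⟩ := (isHermitian_conjTranspose_mul_self D).exists_posSemidef_smul_one_sub
  have hc1 : 0 < c + 1 := by positivity
  refine ⟨(c + 1)⁻¹, inv_pos.2 hc1, ?_⟩
  have h1 := ((hD.add (PosSemidef.one (n := n) (R := ℂ))).conjTranspose_mul_mul_same P).smul
    (inv_pos.2 hc1).le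
  convert h1 using 1
  have h2 : c • (1 : Matrix n n ℂ) - Dᴴ * D + 1 = (c + 1) • 1 - Dᴴ * D := by module
  rw [h2, Matrix.mul_sub, Matrix.sub_mul, smul_sub]
  simp [smul_smul, hc1.ne', Matrix.mul_assoc]

theorem Matrix.IsHermitian.two_le_rank_of_trace_eq_zero {A : Matrix n n ℂ} (hA : A.IsHermitian)
    (htr : A.trace = 0) (h0 : A ≠ 0) : 2 ≤ A.rank := by
  rw [hA.rank_eq_card_non_zero_eigs]
  rw [hA.trace_eq_sum_eigenvalues] at htr
  have htr' : ∑ i, hA.eigenvalues i = 0 := by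
    rw [← RCLike.ofReal_sum] at htr
    exact RCLike.ofReal_eq_zero.1 htr
  rw [Ne, ← hA.eigenvalues_eq_zero_iff] at h0
  by_contra! hlt
  have hsub : Subsingleton {i // hA.eigenvalues i ≠ 0} :=
    Fintype.card_le_one_iff_subsingleton.1 (by omega)
  obtain ⟨i, hi⟩ := Function.ne_iff.1 h0
  rw [Finset.sum_eq_single i] at htr'
  · exact hi htr'
  · intro j _ hj
    by_contra hj'
    exact hj (congrArg Subtype.val (Subsingleton.elim (⟨j, hj'⟩ : {i // hA.eigenvalues i ≠ 0})
      ⟨i, hi⟩))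
  · simp

end PosSemidef

theorem convex_stateSpace (d : ℕ) : Convex ℝ (stateSpace d) := by
  intro A hA B hB a b ha hb hab
  refine ⟨(hA.1.smul ha).add (hB.1.smul hb), ?_⟩
  rw [trace_add, trace_smul, trace_smul, hA.2, hB.2, ← add_smul, hab, one_smul]

theorem Matrix.trace_conjTranspose_mul_self_eq_sum_norm_sq {m n : Type*} [Fintype m] [Fintype n]
    (B : Matrix m n ℂ) : (Bᴴ * B).trace = ((∑ j, ∑ i, ‖B i j‖ ^ 2 : ℝ) : ℂ) := by
  simp [trace, mul_apply, Complex.conj_mul']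

theorem isCompact_stateSpace (d : ℕ) : IsCompact (stateSpace d) := by
  have himage : stateSpace d =
      (fun B : Matrix (Fin d) (Fin d) ℂ => Bᴴ * B) '' {B | (Bᴴ * B).trace = 1} := by
    ext A
    constructor
    · rintro ⟨hA, htr⟩
      obtain ⟨B, rfl⟩ := hA.exists_eq_conjTranspose_mul_self
      exact ⟨B, htr, rfl⟩
    · rintro ⟨B, hB, rfl⟩
      exact ⟨posSemidef_conjTranspose_mul_self B, hB⟩
  rw [himage]
  refine IsCompact.image ?_ (by fun_prop)
  have hbox : IsCompact (Set.univ.pi fun _ : Fin d => Set.univ.pi fun _ : Fin d =>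
      Metric.closedBall (0 : ℂ) 1) :=
    isCompact_univ_pi fun _ => isCompact_univ_pi fun _ => isCompact_closedBall _ _
  refine hbox.of_isClosed_subset (isClosed_eq (by fun_prop) continuous_const) ?_
  intro B hB i _ j _
  have hsum : ∑ j, ∑ i, ‖B i j‖ ^ 2 = 1 := by
    have h := (trace_conjTranspose_mul_self_eq_sum_norm_sq B).symm.trans hB
    exact_mod_cast h
  have h1 : ‖B i j‖ ^ 2 ≤ 1 := by
    rw [← hsum]
    exact (Finset.single_le_sum (f := fun i => ‖B i j‖ ^ 2) (fun _ _ => by positivity)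
      (Finset.mem_univ i)).trans (Finset.single_le_sum (f := fun j => ∑ i, ‖B i j‖ ^ 2)
      (fun _ _ => by positivity) (Finset.mem_univ j))
  simpa using (sq_le_one_iff₀ (norm_nonneg _)).1 h1

theorem exists_add_smul_sub_mem_stateSpace {d : ℕ} {A B : Matrix (Fin d) (Fin d) ℂ}
    (hA : A ∈ stateSpace d) (hB : B ∈ stateSpace d)
    (h : LinearMap.ker A.mulVecLin ≤ LinearMap.ker B.mulVecLin) :
    ∃ ε : ℝ, 0 < ε ∧ A + ε • (A - B) ∈ stateSpace d := by
  obtain ⟨ε, hε, hpos⟩ := hA.1.exists_posSemidef_sub_smul hB.1 h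
  refine ⟨ε, hε, ?_, ?_⟩
  · convert hpos.add (hA.1.smul hε.le) using 1
    module
  · simp [hA.2, hB.2]

/-- The expected value map as a real linear map. -/
noncomputable def expValLinear {d r : ℕ} (u : Fin r → Matrix (Fin d) (Fin d) ℂ) :
    Matrix (Fin d) (Fin d) ℂ →ₗ[ℝ] Fin r → ℝ where
  toFun := expVal u
  map_add' A B := by ext i; simp [expVal, Matrix.mul_add]
  map_smul' c A := by ext i; simp [expVal]

theorem continuous_expVal {d r : ℕ} (u : Fin r → Matrix (Fin d) (Fin d) ℂ) :
    Continuous (expVal u) := by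
  unfold expVal; fun_prop

theorem Matrix.PosSemidef.ker_mulVecLin_add {n : Type*} [Fintype n] {A B : Matrix n n ℂ}
    (hA : A.PosSemidef) (hB : B.PosSemidef) :
    LinearMap.ker (A + B).mulVecLin =
      LinearMap.ker A.mulVecLin ⊓ LinearMap.ker B.mulVecLin := by
  ext x
  simp only [LinearMap.mem_ker, mulVecLin_apply, Submodule.mem_inf, add_mulVec]
  refine ⟨fun h => ?_, fun h => by rw [h.1, h.2, add_zero]⟩
  have hsum : star x ⬝ᵥ A *ᵥ x + star x ⬝ᵥ B *ᵥ x = 0 := by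
    rw [← dotProduct_add, h, dotProduct_zero]
  rw [add_eq_zero_iff_of_nonneg (hA.dotProduct_mulVec_nonneg x) (hB.dotProduct_mulVec_nonneg x)]
    at hsum
  exact ⟨(hA.dotProduct_mulVec_zero_iff x).1 hsum.1, (hB.dotProduct_mulVec_zero_iff x).1 hsum.2⟩

theorem Matrix.ker_mulVecLin_smul {n : Type*} [Fintype n] {c : ℝ} (hc : c ≠ 0)
    (A : Matrix n n ℂ) : LinearMap.ker (c • A).mulVecLin = LinearMap.ker A.mulVecLin := by
  ext x
  simp [hc]


section Openness

theorem mapsOpenAt_of_forall_eq {X Y : Type*} [TopologicalSpace X] [TopologicalSpace Y] [T2Space Y]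
    {f : X → Y} (hf : Continuous f) {K : Set X} (hK : IsCompact K) {x : X}
    (h : ∀ y ∈ K, f y = f x → y = x) : MapsOpenAt f K (f '' K) x := by
  intro N _ hN
  obtain ⟨U, hU, hxU, hUN⟩ := mem_nhdsWithin.1 hN
  refine mem_nhdsWithin.2 ⟨(f '' (K \ U))ᶜ, ((hK.diff hU).image hf).isClosed.isOpen_compl, ?_, ?_⟩
  · rintro ⟨y, ⟨hyK, hyU⟩, hy⟩
    exact hyU (h y hyK hy ▸ hxU)
  · rintro _ ⟨hw, y, hy, rfl⟩
    exact ⟨y, hUN ⟨by_contra fun hyU => hw ⟨y, ⟨hy, hyU⟩, rfl⟩, hy⟩, rfl⟩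

theorem mapsOpenAt_of_image_homothety_mem_nhdsWithin {X Y : Type*} [TopologicalSpace X]
    [AddCommGroup X] [Module ℝ X] [IsTopologicalAddGroup X] [ContinuousSMul ℝ X]
    [TopologicalSpace Y] [AddCommGroup Y] [Module ℝ Y] (f : X →ₗ[ℝ] Y) {K : Set X}
    (hK : IsCompact K) (hconv : Convex ℝ K) {x : X} (hx : x ∈ K)
    (h : ∀ t : ℝ, 0 < t → t ≤ 1 →
      (fun y => f x + t • (y - f x)) '' (f '' K) ∈ 𝓝[f '' K] (f x)) :
    MapsOpenAt f K (f '' K) x := by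
  intro N _ hN
  obtain ⟨U, hU, hxU, hUN⟩ := mem_nhdsWithin.1 hN
  have hsmall : ∀ᶠ t : ℝ in 𝓝 0, ∀ y ∈ K, x + t • (y - x) ∈ U := by
    refine hK.eventually_forall_of_forall_eventually
      (P := fun (t : ℝ) y => x + t • (y - x) ∈ U) fun y _ => ?_
    have hc : Continuous fun p : ℝ × X => x + p.1 • (p.2 - x) := by fun_prop
    exact hc.continuousAt.eventually_mem (hU.mem_nhds (by simpa using hxU))
  obtain ⟨t, ⟨ht, ht1⟩, ht0⟩ := (((hsmall.filter_mono nhdsWithin_le_nhds).and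
    ((gt_mem_nhds (zero_lt_one (α := ℝ))).filter_mono nhdsWithin_le_nhds)).and
    (self_mem_nhdsWithin (a := (0 : ℝ)) (s := Set.Ioi 0))).exists
  refine mem_of_superset (h t ht0 ht1.le) ?_
  rintro _ ⟨_, ⟨y, hy, rfl⟩, rfl⟩
  refine ⟨x + t • (y - x), hUN ⟨ht y hy, ?_⟩, by simp⟩
  exact hconv.add_smul_sub_mem hx hy ⟨le_of_lt ht0, ht1.le⟩

end Openness

section Facet

variable {Y : Type*} [NormedAddCommGroup Y] [NormedSpace ℝ Y] [FiniteDimensional ℝ Y]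

theorem exists_forall_add_mem_of_forall_extend {F : Set Y} (hF : Convex ℝ F) {z : Y} (hz : z ∈ F)
    (hext : ∀ y ∈ F, ∃ ε : ℝ, 0 < ε ∧ z + ε • (z - y) ∈ F) :
    ∃ δ : ℝ, 0 < δ ∧ ∀ v ∈ (affineSpan ℝ F).direction, ‖v‖ < δ → z + v ∈ F := by
  obtain ⟨y, hy⟩ := Set.Nonempty.intrinsicInterior hF ⟨z, hz⟩
  have hyF : y ∈ F := intrinsicInterior_subset hy
  obtain ⟨y', hy', rfl⟩ := mem_intrinsicInterior.1 hy
  obtain ⟨δ, hδ, hball⟩ := Metric.mem_nhds_iff.1 (mem_interior_iff_mem_nhds.1 hy')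
  obtain ⟨ε, hε, hq⟩ := hext _ hyF
  refine ⟨ε / (1 + ε) * δ, by positivity, fun v hv hvδ => ?_⟩
  have hmem : ((1 + ε) / ε) • v +ᵥ (y' : Y) ∈ affineSpan ℝ F :=
    AffineSubspace.vadd_mem_of_mem_direction (Submodule.smul_mem _ _ hv) y'.2
  have hp : ((1 + ε) / ε) • v +ᵥ (y' : Y) ∈ F := by
    refine hball (a := ⟨_, hmem⟩) ?_
    rw [Metric.mem_ball, Subtype.dist_eq, dist_vadd_left, norm_smul, Real.norm_eq_abs,
      abs_of_pos (by positivity)]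
    calc (1 + ε) / ε * ‖v‖ < (1 + ε) / ε * (ε / (1 + ε) * δ) := by gcongr
      _ = δ := by field_simp
  have := hF hq hp (a := 1 / (1 + ε)) (b := ε / (1 + ε)) (by positivity) (by positivity)
    (by field_simp)
  convert this using 1
  rw [vadd_eq_add]
  match_scalars <;> (field_simp; try ring)

theorem image_homothety_mem_nhdsWithin_of_facet {L F : Set Y} (hL : Convex ℝ L)
    (hF : IsFaceOf L F) (hfacet : convDim F + 1 = convDim L) {z : Y} (hz : z ∈ F)
    (hext : ∀ y ∈ F, ∃ ε : ℝ, 0 < ε ∧ z + ε • (z - y) ∈ F) {t : ℝ} (ht : 0 < t) (ht1 : t ≤ 1) :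
    (fun y => z + t • (y - z)) '' L ∈ 𝓝[L] z := by
  obtain ⟨δ, hδ, hball⟩ := exists_forall_add_mem_of_forall_extend hF.1 hz hext
  have hFL := hF.2.subset
  obtain ⟨y, hyL, hyF⟩ : ∃ y ∈ L, y ∉ F := by
    by_contra! hcon
    have : F = L := hFL.antisymm hcon
    simp [this] at hfacet
  set V := (affineSpan ℝ F).direction with hV
  have hyV : y - z ∉ V := by
    intro hyV
    obtain ⟨c, hc, hcδ⟩ : ∃ c : ℝ, 0 < c ∧ c * ‖y - z‖ < δ := by
      refine ⟨δ / (‖y - z‖ + 1), by positivity, ?_⟩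
      rw [div_mul_eq_mul_div, div_lt_iff₀ (by positivity)]
      nlinarith
    have hw : z + (-c) • (y - z) ∈ F := by
      refine hball _ (V.smul_mem _ hyV) ?_
      rwa [norm_smul, norm_neg, Real.norm_eq_abs, abs_of_pos hc]
    refine hyF (hF.2.left_mem_of_mem_openSegment hyL (hFL hw) hz
      ⟨c / (1 + c), 1 / (1 + c), by positivity, by positivity, by field_simp; ring, ?_⟩)
    match_scalars <;> (field_simp; try ring)
  have hspan : (affineSpan ℝ L).direction = V ⊔ ℝ ∙ (y - z) := by
    symm
    apply Submodule.eq_of_le_of_finrank_le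
    · refine sup_le (AffineSubspace.direction_le (affineSpan_mono ℝ hFL)) ?_
      rw [Submodule.span_singleton_le_iff_mem]
      exact AffineSubspace.vsub_mem_direction (subset_affineSpan ℝ L hyL)
        (subset_affineSpan ℝ L (hFL hz))
    · have hlt : V < V ⊔ ℝ ∙ (y - z) := by
        refine lt_of_le_of_ne le_sup_left fun h => hyV ?_
        rw [h]
        exact Submodule.mem_sup_right (Submodule.mem_span_singleton_self _)
      have := Submodule.finrank_lt_finrank_of_lt hlt
      change Module.finrank ℝ V + 1 = Module.finrank ℝ (affineSpan ℝ L).direction at hfacet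
      omega
  obtain ⟨φ, hφy, hφV⟩ : ∃ φ : Y →ₗ[ℝ] ℝ, φ (y - z) = 1 ∧ ∀ v ∈ V, φ v = 0 := by
    obtain ⟨φ, hφ, hφV⟩ := Submodule.exists_le_ker_of_notMem hyV
    refine ⟨(φ (y - z))⁻¹ • φ, inv_mul_cancel₀ hφ, fun v hv => ?_⟩
    simp [LinearMap.mem_ker.1 (hφV hv)]
  -- decomposition of the points of `L` along `V` and `y - z`
  have hdec : ∀ w ∈ L, w - z - φ (w - z) • (y - z) ∈ V := by
    intro w hw
    have hmem : w - z ∈ V ⊔ ℝ ∙ (y - z) := hspan ▸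
      AffineSubspace.vsub_mem_direction (subset_affineSpan ℝ L hw) (subset_affineSpan ℝ L (hFL hz))
    obtain ⟨v, hv, x, hx, hvx⟩ := Submodule.mem_sup.1 hmem
    obtain ⟨a, rfl⟩ := Submodule.mem_span_singleton.1 hx
    rw [← hvx]
    simpa [hφV v hv, hφy] using hv
  have hφc : Continuous φ := φ.continuous_of_finiteDimensional
  have hnorm : ∀ᶠ w in 𝓝 z, ‖w - z - φ (w - z) • (y - z)‖ < t * δ / 2 := by
    have hc : Continuous fun w => ‖w - z - φ (w - z) • (y - z)‖ := by fun_prop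
    exact hc.continuousAt.eventually_lt continuousAt_const (by simp; positivity)
  have habs : ∀ᶠ w in 𝓝 z, φ (w - z) < t / 2 := by
    have hc : Continuous fun w => φ (w - z) := by fun_prop
    exact hc.continuousAt.eventually_lt continuousAt_const (by simp; positivity)
  filter_upwards [self_mem_nhdsWithin, nhdsWithin_le_nhds hnorm, nhdsWithin_le_nhds habs]
    with w hw hwn hws
  have hv := hdec w hw
  obtain ⟨s, hs⟩ : ∃ s, s = φ (w - z) := ⟨_, rfl⟩
  rw [← hs] at hwn hws hv
  obtain ⟨v, hvdef⟩ : ∃ v, v = w - z - s • (y - z) := ⟨_, rfl⟩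
  rw [← hvdef] at hwn hv
  have hwv : w = z + v + s • (y - z) := by rw [hvdef]; module
  have hs0 : 0 ≤ s := by
    by_contra! hneg
    have hp : z + (1 / (1 - s)) • v ∈ F := by
      refine hball _ (V.smul_mem _ hv) ?_
      rw [norm_smul, Real.norm_eq_abs, abs_of_pos (div_pos one_pos (by linarith))]
      have : 1 / (1 - s) ≤ 1 := by rw [div_le_one (by linarith)]; linarith
      nlinarith [norm_nonneg v]
    have h1s : 0 < 1 - s := by linarith
    refine hyF (hF.2.left_mem_of_mem_openSegment hyL hw hp
      ⟨-s / (1 - s), 1 / (1 - s), div_pos (by linarith) h1s, by positivity, by field_simp; ring, ?_⟩)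
    rw [hwv]
    match_scalars <;> (field_simp; try ring)
  have hts : 0 < t - s := by linarith
  have hp : z + (1 / (t - s)) • v ∈ F := by
    refine hball _ (V.smul_mem _ hv) ?_
    rw [norm_smul, Real.norm_eq_abs, abs_of_pos (by positivity), one_div_mul_eq_div,
      div_lt_iff₀ hts]
    nlinarith
  refine ⟨(1 - s / t) • (z + (1 / (t - s)) • v) + (s / t) • y,
    hL (hFL hp) hyL ?_ (by positivity) (by ring), ?_⟩
  · rw [sub_nonneg, div_le_one ht]; linarith
  · rw [hwv]
    match_scalars <;> (field_simp; try ring)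

end Facet

theorem open_on_preimage_of_facet {r : ℕ}
    (u : Fin r → Matrix (Fin 3) (Fin 3) ℂ) (hu : ∀ i, (u i).IsHermitian)
    (F : Set (Fin r → ℝ)) (hF : IsFaceOf (expVal u '' stateSpace 3) F)
    (hfacet : convDim F + 1 = convDim (expVal u '' stateSpace 3)) :
    ∀ ρ ∈ stateSpace 3, expVal u ρ ∈ F →
      MapsOpenAt (expVal u) (stateSpace 3) (expVal u '' stateSpace 3) ρ := by
  intro ρ hρ hρF
  by_cases hext : ∀ y ∈ F, ∃ ε : ℝ, 0 < ε ∧ expVal u ρ + ε • (expVal u ρ - y) ∈ F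
  · exact mapsOpenAt_of_image_homothety_mem_nhdsWithin (expValLinear u) (isCompact_stateSpace 3)
      (convex_stateSpace 3) hρ fun t ht ht1 => image_homothety_mem_nhdsWithin_of_facet
        ((convex_stateSpace 3).linear_image (expValLinear u)) hF hfacet hρF hext ht ht1
  · push Not at hext
    obtain ⟨_, hyF, hy⟩ := hext
    obtain ⟨π, hπ, rfl⟩ := hF.2.subset hyF
    refine mapsOpenAt_of_forall_eq (continuous_expVal u) (isCompact_stateSpace 3)
      fun σ hσ hσρ => by_contra fun hne => ?_
    have hproper : ∃ κ ∈ stateSpace 3, expVal u κ ∉ F := by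
      by_contra! hcon
      have : F = expVal u '' stateSpace 3 :=
        hF.2.subset.antisymm (Set.image_subset_iff.2 hcon)
      rw [← this] at hfacet
      omega
    obtain ⟨κ, hκ, hκF⟩ := hproper
    -- a state whose kernel lies in the kernel of another one can be extended beyond it
    have hmem : ∀ α ∈ stateSpace 3, ∀ β ∈ stateSpace 3, expVal u α ∈ F →
        LinearMap.ker α.mulVecLin ≤ LinearMap.ker β.mulVecLin →
        ∃ ε : ℝ, 0 < ε ∧ expVal u β ∈ F ∧ expVal u α + ε • (expVal u α - expVal u β) ∈ F := by
      intro α hα β hβ hαF hker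
      obtain ⟨ε, hε, hω⟩ := exists_add_smul_sub_mem_stateSpace hα hβ hker
      have hωL : expVal u α + ε • (expVal u α - expVal u β) ∈ expVal u '' stateSpace 3 :=
        ⟨_, hω, 
          (map_add (expValLinear u) α (ε • (α - β))).trans (by rw [map_smul, map_sub]; rfl)⟩
      have hseg : expVal u α ∈ openSegment ℝ (expVal u β)
          (expVal u α + ε • (expVal u α - expVal u β)) := by
        refine ⟨ε / (1 + ε), 1 / (1 + ε), by positivity, by positivity, by field_simp; ring, ?_⟩
        match_scalars <;> (field_simp; try ring)
      exact ⟨ε, hε, hF.2.left_mem_of_mem_openSegment ⟨β, hβ, rfl⟩ hωL hαF hseg,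
        hF.2.right_mem_of_mem_openSegment ⟨β, hβ, rfl⟩ hωL hαF hseg⟩
    obtain ⟨τ, hτ⟩ : ∃ τ, τ = (1 / 2 : ℝ) • ρ + (1 / 2 : ℝ) • σ := ⟨_, rfl⟩
    have hτK : τ ∈ stateSpace 3 :=
      hτ ▸ convex_stateSpace 3 hρ hσ (by norm_num) (by norm_num) (by norm_num)
    have hτρ : expVal u τ = expVal u ρ := by
      have h : expVal u τ = (1 / 2 : ℝ) • expVal u ρ + (1 / 2 : ℝ) • expVal u σ := by
        subst hτ
        exact (map_add (expValLinear u) _ _).trans (by simp only [map_smul]; rfl)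
      rw [h, hσρ, ← add_smul]
      norm_num
    have hτF : expVal u τ ∈ F := hτρ ▸ hρF
    have hkerπ : ¬ LinearMap.ker τ.mulVecLin ≤ LinearMap.ker π.mulVecLin := by
      intro hker
      obtain ⟨ε, hε, -, hεF⟩ := hmem τ hτK π hπ hτF hker
      exact hy ε hε (hτρ ▸ hεF)
    have hrank : Module.finrank ℂ (LinearMap.ker τ.mulVecLin) ≤ 1 := by
      have hδ : (ρ - σ).IsHermitian := hρ.1.isHermitian.sub hσ.1.isHermitian
      have h2 := hδ.two_le_rank_of_trace_eq_zero (by simp [hρ.2, hσ.2])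
        (sub_ne_zero.2 (Ne.symm hne))
      have hker : LinearMap.ker τ.mulVecLin ≤ LinearMap.ker (ρ - σ).mulVecLin := by
        rw [hτ, PosSemidef.ker_mulVecLin_add (hρ.1.smul (by norm_num)) (hσ.1.smul (by norm_num)),
          ker_mulVecLin_smul (by norm_num), ker_mulVecLin_smul (by norm_num)]
        rintro x ⟨hxρ, hxσ⟩
        have hxρ' : ρ *ᵥ x = 0 := hxρ
        have hxσ' : σ *ᵥ x = 0 := hxσ
        simp [hxρ', hxσ']
      have h3 := (ρ - σ).mulVecLin.finrank_range_add_finrank_ker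
      have h4 := Submodule.finrank_mono hker
      simp only [Module.finrank_fin_fun] at h3
      unfold Matrix.rank at h2
      omega
    have hlt : LinearMap.ker τ.mulVecLin ⊓ LinearMap.ker π.mulVecLin <
        LinearMap.ker τ.mulVecLin :=
      inf_le_left.lt_of_ne fun h => hkerπ (inf_eq_left.1 h)
    have hbot : LinearMap.ker τ.mulVecLin ⊓ LinearMap.ker π.mulVecLin = ⊥ := by
      have := Submodule.finrank_lt_finrank_of_lt hlt
      exact Submodule.finrank_eq_zero.1 (by omega)
    have hωF : expVal u ((1 / 2 : ℝ) • τ + (1 / 2 : ℝ) • π) ∈ F := by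
      have h : expVal u ((1 / 2 : ℝ) • τ + (1 / 2 : ℝ) • π) =
          (1 / 2 : ℝ) • expVal u τ + (1 / 2 : ℝ) • expVal u π :=
        (map_add (expValLinear u) _ _).trans (by simp only [map_smul]; rfl)
      rw [h]
      exact hF.1 hτF hyF (by norm_num) (by norm_num) (by norm_num)
    obtain ⟨-, -, h, -⟩ := hmem _ (convex_stateSpace 3 hτK hπ (by norm_num) (by norm_num)
      (by norm_num)) κ hκ hωF (by
        rw [PosSemidef.ker_mulVecLin_add (hτK.1.smul (by norm_num)) (hπ.1.smul (by norm_num)),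
          ker_mulVecLin_smul (by norm_num), ker_mulVecLin_smul (by norm_num), hbot]
        exact bot_le)
    exact hκF h
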